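/- arXiv:hep-th/9610061 — 2 statements merged into one kernel-verified Lean document; each statement's English description precedes it below -/
import Mathlib

section
/- Let x = x_C be the CGHS map x_C(y) = −log(1 + e^{−y}). There exists a constant C > 0 such that for every integrable f : ℝ → ℂ with f̂(p) = 0 for a.e. p ≤ 0, one has N̄_o[f] ≤ C ∫_0^∞ |f̂(p)|²/(2p(1 − e^{−2πp})) dp (an inequality in [0, ∞]). -/
open MeasureTheory Set Filter
open scoped ENNReal

/-- The Fourier transform `f̂(p) = (2π)^{-1/2} ∫ f(y) e^{-ipy} dy`. -/
noncomputable def ft (f : ℝ → ℂ) (p : ℝ) : ℂ :=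
  (Real.sqrt (2 * Real.pi) : ℂ)⁻¹ *
    ∫ y : ℝ, f y * Complex.exp (-Complex.I * (p : ℂ) * (y : ℂ))

/-- `F̌(k) = (2π)^{-1/2} ∫ f(y) e^{-ik x(y)} dy`. -/
noncomputable def Fk (x : ℝ → ℝ) (f : ℝ → ℂ) (k : ℝ) : ℂ :=
  (Real.sqrt (2 * Real.pi) : ℂ)⁻¹ *
    ∫ y : ℝ, f y * Complex.exp (-Complex.I * (k : ℂ) * (x y : ℂ))

/-- The relativistic black-hole coordinate map `x_R(y) = -e^{-y}`. -/
noncomputable def xR (y : ℝ) : ℝ := -Real.exp (-y)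

/-- The CGHS black-hole coordinate map `x_C(y) = -log(1+e^{-y})`. -/
noncomputable def xC (y : ℝ) : ℝ := -Real.log (1 + Real.exp (-y))

/-- The mean number of spontaneously created particles `N̄_o[f]`. -/
noncomputable def No (x : ℝ → ℝ) (f : ℝ → ℂ) : ℝ≥0∞ :=
  ∫⁻ k in Set.Ioi (0:ℝ), ENNReal.ofReal (‖Fk x f (-k)‖ ^ 2 / (2 * k))

/-- The thermal mean particle number `N̄^Th_β[f]` at inverse temperature `β`. -/
noncomputable def Nth (β : ℝ) (f : ℝ → ℂ) : ℝ≥0∞ :=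
  ∫⁻ p in Set.Ioi (0:ℝ),
    ENNReal.ofReal (‖ft f p‖ ^ 2 / (2 * p * (Real.exp (β * p) - 1)))

/-- translate of `f` by `y₀`. -/
noncomputable def tr (f : ℝ → ℂ) (y₀ : ℝ) : ℝ → ℂ := fun y => f (y - y₀)

open scoped FourierTransform

theorem ft_eq_fourier (u : ℝ → ℂ) (p : ℝ) :
    ft u p = (Real.sqrt (2 * Real.pi) : ℂ)⁻¹ * 𝓕 u (p / (2 * Real.pi)) := by
  rw [ft, Real.fourier_real_eq_integral_exp_smul]
  congr 2
  ext y
  rw [smul_eq_mul, mul_comm]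
  congr 2
  have : (Real.pi : ℂ) ≠ 0 := by exact_mod_cast Real.pi_ne_zero
  push_cast
  field_simp

/-- The `L²` Fourier transform of an integrable square-integrable function is given by the Fourier
integral. -/
theorem fourier_toLp_ae_eq {u : ℝ → ℂ} (h1 : Integrable u) (h2 : MemLp u 2) :
    (𝓕 h2.toLp : Lp ℂ 2 (volume : Measure ℝ)) =ᵐ[volume] 𝓕 u := by
  have hcont : Continuous (𝓕 u) :=
    VectorFourier.fourierIntegral_continuous Real.continuous_fourierChar
      (by exact continuous_inner) h1
  refine ae_eq_of_integral_contDiff_smul_eq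
    ((Lp.memLp (𝓕 h2.toLp : Lp ℂ 2 (volume : Measure ℝ))).locallyIntegrable (by norm_num))
    hcont.locallyIntegrable fun g hg hgs => ?_
  let G : SchwartzMap ℝ ℂ := HasCompactSupport.toSchwartzMap (f := fun x => (g x : ℂ))
    (hgs.comp_left Complex.ofReal_zero) (Complex.ofRealCLM.contDiff.comp hg)
  have key := congrArg (fun T => T G) (Lp.fourier_toTemperedDistribution_eq h2.toLp)
  simp only [TemperedDistribution.fourier_apply, Lp.toTemperedDistribution_apply] at key
  calc ∫ x, g x • (𝓕 h2.toLp : Lp ℂ 2 (volume : Measure ℝ)) x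
      = ∫ x, G x • (𝓕 h2.toLp : Lp ℂ 2 (volume : Measure ℝ)) x := rfl
    _ = ∫ x, (𝓕 G) x • h2.toLp u x := key.symm
    _ = ∫ x, (𝓕 (G : ℝ → ℂ)) x • u x := by
      apply integral_congr_ae
      filter_upwards [h2.coeFn_toLp] with x hx
      rw [hx, SchwartzMap.fourier_coe]
    _ = ∫ x, G x • 𝓕 u x := by
      have := VectorFourier.integral_fourierIntegral_smul_eq_flip (L := innerₗ ℝ)
        (μ := volume) (ν := volume) Real.continuous_fourierChar
        (by exact continuous_inner) G.integrable h1
      rwa [flip_innerₗ] at this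
    _ = ∫ x, g x • 𝓕 u x := rfl

theorem lintegral_enorm_fourier_sq {u : ℝ → ℂ} (h1 : Integrable u) (h2 : MemLp u 2) :
    ∫⁻ x, ‖𝓕 u x‖ₑ ^ 2 = ∫⁻ x, ‖u x‖ₑ ^ 2 := by
  have e (v : ℝ → ℂ) : ∫⁻ x, ‖v x‖ₑ ^ 2 = eLpNorm v 2 volume ^ 2 := by
    rw [eLpNorm_eq_lintegral_rpow_enorm_toReal (by norm_num) (by norm_num),
      ← ENNReal.rpow_natCast, ← ENNReal.rpow_mul]
    simp
  rw [e, e, ← eLpNorm_congr_ae (fourier_toLp_ae_eq h1 h2), ← eLpNorm_congr_ae h2.coeFn_toLp,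
    ← Lp.enorm_def, ← Lp.enorm_def, ← ofReal_norm, ← ofReal_norm, Lp.norm_fourier_eq]

/-- Plancherel's theorem in the normalisation of `ft`. -/
theorem lintegral_enorm_ft_sq {u : ℝ → ℂ} (h1 : Integrable u) (h2 : MemLp u 2) :
    ∫⁻ p, ‖ft u p‖ₑ ^ 2 = ∫⁻ x, ‖u x‖ₑ ^ 2 := by
  rw [← lintegral_enorm_fourier_sq h1 h2]
  have hpi : (0 : ℝ) < 2 * Real.pi := by positivity
  have hscale : ∫⁻ p : ℝ, ‖𝓕 u (p * (2 * Real.pi)⁻¹)‖ₑ ^ 2 =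
      ENNReal.ofReal (2 * Real.pi) * ∫⁻ x, ‖𝓕 u x‖ₑ ^ 2 := by
    have h := Real.map_volume_mul_right (inv_ne_zero hpi.ne')
    rw [inv_inv, abs_of_pos hpi] at h
    have h' := lintegral_smul_measure (μ := volume) (ENNReal.ofReal (2 * Real.pi))
      (fun x => ‖𝓕 u x‖ₑ ^ 2)
    rw [smul_eq_mul] at h'
    rw [← h', ← h]
    exact (lintegral_map_equiv
      (fun x => ‖𝓕 u x‖ₑ ^ 2) (MeasurableEquiv.mulRight₀ _ (inv_ne_zero hpi.ne'))).symm
  have hc : ‖(Real.sqrt (2 * Real.pi) : ℂ)⁻¹‖ₑ ^ 2 = ENNReal.ofReal (2 * Real.pi)⁻¹ := by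
    rw [← ofReal_norm, ← ENNReal.ofReal_pow (norm_nonneg _), norm_inv, Complex.norm_real,
      Real.norm_of_nonneg (Real.sqrt_nonneg _), inv_pow, Real.sq_sqrt hpi.le]
  simp_rw [ft_eq_fourier, enorm_mul, mul_pow, hc, div_eq_mul_inv]
  rw [lintegral_const_mul' _ _ ENNReal.ofReal_ne_top, hscale, ← mul_assoc,
    ← ENNReal.ofReal_mul (by positivity), inv_mul_cancel₀ hpi.ne', ENNReal.ofReal_one, one_mul]

theorem ft_convolution {f g : ℝ → ℂ} (hf : Integrable f) (hg : Integrable g) (p : ℝ) :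
    ft (convolution f g (ContinuousLinearMap.mul ℂ ℂ) volume) p =
      Real.sqrt (2 * Real.pi) * (ft f p * ft g p) := by
  have hpi : (Real.sqrt (2 * Real.pi) : ℂ) ≠ 0 := by
    exact_mod_cast (Real.sqrt_pos.2 (by positivity)).ne'
  simp only [ft_eq_fourier]
  rw [Real.fourier_mul_convolution_eq hf hg]
  field_simp

/-- The integrand of Euler's integral for `Γ(r) a^{-r}` in the logarithmic variable `s = log t`. -/
noncomputable def gammaKernel (r a : ℂ) (s : ℝ) : ℂ := Complex.exp (r * s - a * Real.exp s)

theorem norm_gammaKernel (r a : ℂ) (s : ℝ) :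
    ‖gammaKernel r a s‖ = Real.exp (r.re * s - a.re * Real.exp s) := by
  rw [gammaKernel, Complex.norm_exp, Complex.sub_re, Complex.re_mul_ofReal, Complex.re_mul_ofReal]

theorem continuous_gammaKernel (r a : ℂ) : Continuous (gammaKernel r a) := by
  unfold gammaKernel
  fun_prop

theorem gammaKernel_eq (r a : ℂ) (s : ℝ) : gammaKernel r a s =
    |Real.exp s| • ((Real.exp s : ℂ) ^ (r - 1) * Complex.exp (-(a * Real.exp s))) := by
  have h0 : (Real.exp s : ℂ) ≠ 0 := by exact_mod_cast (Real.exp_pos s).ne'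
  rw [abs_of_pos (Real.exp_pos s), Complex.cpow_def_of_ne_zero h0, ← Complex.ofReal_log
    (Real.exp_pos s).le, Real.log_exp, Complex.real_smul, Complex.ofReal_exp, ← Complex.exp_add,
    ← Complex.exp_add, gammaKernel, Complex.ofReal_exp]
  congr 1
  ring

theorem integrable_gammaKernel {r a : ℂ} (hr : 0 < r.re) (ha : 0 < a.re) :
    Integrable (gammaKernel r a) := by
  have hreal : Integrable (gammaKernel r.re a.re) := by
    have h0 : IntegrableOn (fun t : ℝ => (t : ℂ) ^ ((r.re : ℂ) - 1) *
        Complex.exp (-(a.re * t : ℂ))) (Real.exp '' univ) := by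
      rw [image_univ, Real.range_exp]
      have := integrableOn_rpow_mul_exp_neg_mul_rpow (s := r.re - 1) (p := 1) (b := a.re)
        (by linarith) one_pos ha
      refine IntegrableOn.congr_fun (this.ofReal (𝕜 := ℂ)) (fun t ht => ?_) measurableSet_Ioi
      simp only [Real.rpow_one]
      push_cast [Complex.ofReal_cpow (le_of_lt ht)]
      rw [← Complex.ofReal_one, ← Complex.ofReal_sub, ← Complex.ofReal_cpow (le_of_lt ht)]
      norm_num
    rw [integrableOn_image_iff_integrableOn_abs_deriv_smul MeasurableSet.univ
      (fun x _ => (Real.hasDerivAt_exp x).hasDerivWithinAt) Real.exp_injective.injOn,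
      integrableOn_univ] at h0
    exact h0.congr (.of_forall fun s => (gammaKernel_eq _ _ s).symm)
  refine hreal.mono (continuous_gammaKernel r a).aestronglyMeasurable (.of_forall fun s => ?_)
  simp [norm_gammaKernel]

theorem integral_gammaKernel_ofReal {r : ℂ} {a : ℝ} (hr : 0 < r.re) (ha : 0 < a) :
    ∫ s, gammaKernel r a s = (a : ℂ) ^ (-r) * Complex.Gamma r := by
  rw [Complex.cpow_neg, ← Complex.inv_cpow _ _ (by
    rw [Complex.arg_ofReal_of_nonneg ha.le]; exact Real.pi_pos.ne), ← one_div,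
    ← Complex.integral_cpow_mul_exp_neg_mul_Ioi hr ha, ← Real.range_exp, ← image_univ,
    integral_image_eq_integral_abs_deriv_smul MeasurableSet.univ
      (fun x _ => (Real.hasDerivAt_exp x).hasDerivWithinAt) Real.exp_injective.injOn,
      setIntegral_univ]
  simp_rw [gammaKernel_eq]

theorem hasDerivAt_integral_gammaKernel {r a : ℂ} (hr : 0 < r.re) (ha : 0 < a.re) :
    HasDerivAt (fun a => ∫ s, gammaKernel r a s) (∫ s, -gammaKernel (r + 1) a s) a := by
  have hnhds : {z : ℂ | a.re / 2 < z.re} ∈ nhds a :=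
    (isOpen_lt continuous_const Complex.continuous_re).mem_nhds (by simp only [mem_ofPred]; linarith)
  refine (hasDerivAt_integral_of_dominated_loc_of_deriv_le
    (bound := fun s => ‖gammaKernel (r + 1) (a.re / 2 : ℝ) s‖) hnhds
    (.of_forall fun z => (continuous_gammaKernel r z).aestronglyMeasurable)
    (integrable_gammaKernel hr ha)
    (F' := fun z s => -gammaKernel (r + 1) z s)
    (continuous_gammaKernel _ _).neg.aestronglyMeasurable (.of_forall fun s z hz => ?_)
    (integrable_gammaKernel (by simp; linarith) (by simpa using ha)).norm
    (.of_forall fun s z _ => ?_)).2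
  · rw [norm_neg, norm_gammaKernel, norm_gammaKernel, Complex.ofReal_re]
    have := mul_le_mul_of_nonneg_right (le_of_lt hz) (Real.exp_pos s).le
    gcongr
  · have h : HasDerivAt (fun z : ℂ => Complex.exp (r * s - z * Real.exp s))
        (Complex.exp (r * s - z * Real.exp s) * (0 - 1 * Real.exp s)) z :=
      ((hasDerivAt_const z _).sub ((hasDerivAt_id z).mul_const _)).cexp
    convert! h using 1
    rw [gammaKernel, add_mul, add_sub_right_comm, Complex.exp_add, one_mul, Complex.ofReal_exp]
    ring

/-- Euler's integral for the Gamma function with a complex scale parameter. -/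
theorem integral_gammaKernel {r a : ℂ} (hr : 0 < r.re) (ha : 0 < a.re) :
    ∫ s, gammaKernel r a s = a ^ (-r) * Complex.Gamma r := by
  have hopen : IsOpen {z : ℂ | 0 < z.re} := isOpen_lt continuous_const Complex.continuous_re
  have hL : AnalyticOnNhd ℂ (fun a => ∫ s, gammaKernel r a s) {z : ℂ | 0 < z.re} :=
    DifferentiableOn.analyticOnNhd (fun z hz =>
      (hasDerivAt_integral_gammaKernel hr hz).differentiableAt.differentiableWithinAt) hopen
  have hR : AnalyticOnNhd ℂ (fun a => a ^ (-r) * Complex.Gamma r) {z : ℂ | 0 < z.re} :=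
    DifferentiableOn.analyticOnNhd (fun z hz =>
      ((differentiableAt_id.cpow_const (Or.inl hz)).mul_const _).differentiableWithinAt) hopen
  have hfreq : ∃ᶠ z : ℂ in nhdsWithin 1 {1}ᶜ,
      ∫ s, gammaKernel r z s = z ^ (-r) * Complex.Gamma r := by
    have ht : Tendsto (fun x : ℝ => (x : ℂ)) (nhdsWithin 1 (Ioi 1)) (nhdsWithin 1 {1}ᶜ) := by
      refine tendsto_nhdsWithin_iff.2 ⟨?_, ?_⟩
      · exact (Complex.continuous_ofReal.tendsto' 1 1 (by simp)).mono_left nhdsWithin_le_nhds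
      · filter_upwards [self_mem_nhdsWithin] with x hx
        simpa using (ne_of_gt hx)
    refine ht.frequently (Eventually.frequently ?_)
    filter_upwards [self_mem_nhdsWithin] with x hx
    exact integral_gammaKernel_ofReal hr (zero_lt_one.trans hx)
  exact hL.eqOn_of_preconnected_of_frequently_eq hR
    (convex_halfSpace_re_gt 0).isPreconnected (z₀ := 1) (by simp) hfreq ha

theorem Complex.norm_Gamma_le_Gamma_re {s : ℂ} (hs : 0 < s.re) :
    ‖Complex.Gamma s‖ ≤ Real.Gamma s.re := by
  have h := norm_integral_le_integral_norm (μ := volume) (gammaKernel s 1)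
  rw [integral_gammaKernel hs (by simp), Complex.one_cpow, one_mul] at h
  have h' : ((∫ x, ‖gammaKernel s 1 x‖ : ℝ) : ℂ) = Real.Gamma s.re := by
    have := integral_gammaKernel (r := s.re) (a := 1) hs (by simp)
    rw [Complex.one_cpow, one_mul, Complex.Gamma_ofReal] at this
    rw [← this, ← integral_complex_ofReal]
    congr 1
    ext x
    rw [norm_gammaKernel, gammaKernel]
    push_cast
    simp
  rwa [Complex.ofReal_inj.1 h'] at h

theorem norm_integral_gammaKernel_le {δ p : ℝ} (hδ : 0 < δ) (hδ1 : δ ≤ 1) (hp : 0 < p) :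
    ‖∫ s, gammaKernel (δ - Complex.I * p) (δ + Complex.I) s‖ ≤ 1 / p := by
  set r : ℂ := δ - Complex.I * p with hr
  set a : ℂ := δ + Complex.I with ha
  have hrre : r.re = δ := by simp [hr]
  have hrim : r.im = -p := by simp [hr]
  have hare : a.re = δ := by simp [ha]
  have haim : a.im = 1 := by simp [ha]
  have hrp : p ≤ ‖r‖ := by simpa [hrim, abs_of_pos hp] using Complex.abs_im_le_norm r
  have ha1 : 1 ≤ ‖a‖ := by simpa [haim] using Complex.abs_im_le_norm a
  have ha0 : a ≠ 0 := norm_pos_iff.1 (by linarith)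
  rw [integral_gammaKernel (by rwa [hrre]) (by rwa [hare]), norm_mul,
    Complex.norm_cpow_of_ne_zero ha0, Complex.neg_re, Complex.neg_im, hrre, hrim, neg_neg]
  have hpow : ‖a‖ ^ (-δ) / Real.exp (a.arg * p) ≤ 1 := by
    rw [div_le_one (Real.exp_pos _)]
    exact (Real.rpow_le_one_of_one_le_of_nonpos ha1 (by linarith)).trans
      (Real.one_le_exp (mul_nonneg (Complex.arg_nonneg_iff.2 (by simp [haim])) hp.le))
  have hΓ : ‖Complex.Gamma r‖ ≤ 1 / p := by
    have h1 := Complex.norm_Gamma_le_Gamma_re (s := r + 1) (by simp [hrre]; linarith)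
    rw [Complex.Gamma_add_one _ (norm_pos_iff.1 (hp.trans_le hrp)), norm_mul, Complex.add_re,
      hrre, Complex.one_re] at h1
    have h2 : Real.Gamma (δ + 1) ≤ 1 := by
      have := Real.convexOn_Gamma.2 (x := 1) (y := 2) (by simp) (by simp)
        (sub_nonneg.2 hδ1) hδ.le (by ring)
      rw [Real.Gamma_one, Real.Gamma_two] at this
      simp only [smul_eq_mul] at this
      rw [show (1 - δ) * 1 + δ * 2 = δ + 1 by ring] at this
      linarith
    rw [le_div_iff₀ hp, mul_comm]
    exact (mul_le_mul_of_nonneg_right hrp (norm_nonneg _)).trans (h1.trans h2)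
  calc _ ≤ 1 * (1 / p) := mul_le_mul hpow hΓ (norm_nonneg _) zero_le_one
    _ = 1 / p := one_mul _

theorem Complex.norm_Gamma_I_mul_sq {k : ℝ} (hk : 0 < k) :
    ‖Complex.Gamma (Complex.I * k)‖ ^ 2 = Real.pi / (k * Real.sinh (Real.pi * k)) := by
  have h0 : -(Complex.I * k) ≠ 0 := by simp [hk.ne']
  have h := congrArg norm (Complex.Gamma_mul_Gamma_one_sub (Complex.I * k))
  have hconj : Complex.Gamma (-(Complex.I * k)) =
      (starRingEnd ℂ) (Complex.Gamma (Complex.I * k)) := by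
    rw [← Complex.Gamma_conj]
    simp
  have hsin : Complex.sin (Real.pi * (Complex.I * k)) =
      (Real.sinh (Real.pi * k) : ℂ) * Complex.I := by
    rw [Complex.ofReal_sinh, ← Complex.sin_mul_I]
    push_cast
    ring_nf
  have hsinh : 0 < Real.sinh (Real.pi * k) := Real.sinh_pos_iff.2 (by positivity)
  rw [sub_eq_neg_add, Complex.Gamma_add_one _ h0, hconj, hsin] at h
  simp only [norm_mul, norm_neg, norm_div, Complex.norm_I, Complex.norm_real, RCLike.norm_conj,
    Real.norm_eq_abs, abs_of_pos hk, abs_of_pos hsinh, abs_of_pos Real.pi_pos, one_mul,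
    mul_one] at h
  rw [eq_div_iff (by positivity)]
  rw [eq_div_iff hsinh.ne'] at h
  linear_combination h

theorem le_norm_cpow_mul_Gamma_sq {k : ℝ} (hk : 0 < k) :
    2 * Real.pi / k ≤
      ‖Complex.I ^ (-(Complex.I * k)) * Complex.Gamma (Complex.I * k)‖ ^ 2 := by
  have hsinh : 0 < Real.sinh (Real.pi * k) := Real.sinh_pos_iff.2 (by positivity)
  rw [norm_mul, mul_pow, Complex.norm_Gamma_I_mul_sq hk,
    Complex.norm_cpow_of_ne_zero Complex.I_ne_zero, Complex.arg_I]
  simp only [Complex.norm_I, Real.one_rpow, Complex.neg_im, Complex.mul_im, Complex.I_re,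
    Complex.I_im, Complex.ofReal_im, Complex.ofReal_re, zero_mul, one_mul, zero_add]
  rw [one_div, ← Real.exp_neg, ← Real.exp_nat_mul, ← mul_div_assoc, div_le_div_iff₀ hk
    (by positivity)]
  have he : Real.exp ((2 : ℕ) * -(Real.pi / 2 * -k)) = Real.exp (Real.pi * k) := by
    congr 1
    push_cast
    ring
  have h2 : 2 * Real.sinh (Real.pi * k) ≤ Real.exp (Real.pi * k) := by
    rw [Real.sinh_eq]
    linarith [Real.exp_pos (-(Real.pi * k))]
  rw [he]
  nlinarith [mul_le_mul_of_nonneg_left h2 (show 0 ≤ Real.pi * k by positivity)]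

theorem tendsto_integral_gammaKernel {k : ℝ} (hk : 0 < k) :
    Tendsto (fun δ : ℝ => ∫ s, gammaKernel (2 * δ + Complex.I * k) (δ + Complex.I) s)
      (nhdsWithin 0 (Ioi 0))
      (nhds (Complex.I ^ (-(Complex.I * k)) * Complex.Gamma (Complex.I * k))) := by
  have hr : ContinuousAt (fun δ : ℝ => (2 * δ + Complex.I * k : ℂ)) 0 := by fun_prop
  have ha : ContinuousAt (fun δ : ℝ => (δ + Complex.I : ℂ)) 0 := by fun_prop
  have hpow := ha.cpow hr.neg (by simp [Complex.mem_slitPlane_iff])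
  have hΓ := ContinuousAt.comp (f := fun δ : ℝ => (2 * δ + Complex.I * k : ℂ)) (x := 0)
    (Complex.continuousAt_Gamma _ fun m h => by
      simpa [hk.ne'] using congrArg Complex.im h) hr
  have h : ContinuousAt (fun δ : ℝ => (δ + Complex.I : ℂ) ^ (-(2 * δ + Complex.I * k : ℂ)) *
      Complex.Gamma (2 * δ + Complex.I * k)) 0 := hpow.mul hΓ
  rw [ContinuousAt, Complex.ofReal_zero, mul_zero, zero_add, zero_add] at h
  refine (h.mono_left nhdsWithin_le_nhds).congr' ?_
  filter_upwards [self_mem_nhdsWithin] with δ hδ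
  have hδ' : 0 < δ := hδ
  rw [integral_gammaKernel (by simpa using hδ') (by simpa using hδ')]

theorem MeasureTheory.Integrable.memLp_two_of_norm_le {u : ℝ → ℂ} (hu : Integrable u) {B : ℝ}
    (hB : ∀ x, ‖u x‖ ≤ B) : MemLp u 2 := by
  rw [memLp_two_iff_integrable_sq_norm hu.aestronglyMeasurable]
  simp_rw [sq]
  exact hu.norm.bdd_mul (c := B) hu.norm.aestronglyMeasurable
    (.of_forall fun x => by rw [norm_norm]; exact hB x)

theorem norm_gammaKernel_le_one {δ : ℝ} (hδ : 0 ≤ δ) (s : ℝ) :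
    ‖gammaKernel δ (δ + Complex.I) s‖ ≤ 1 := by
  rw [norm_gammaKernel]
  simp only [Complex.ofReal_re, Complex.add_re, Complex.I_re, add_zero]
  rw [Real.exp_le_one_iff, ← mul_sub]
  exact mul_nonpos_of_nonneg_of_nonpos hδ (by linarith [Real.add_one_le_exp s])

theorem exp_sub_xC (s t : ℝ) : Real.exp (s - xC t) = Real.exp s * (1 + Real.exp (-t)) := by
  rw [xC, sub_neg_eq_add, Real.exp_add, Real.exp_log (by positivity)]

theorem gammaKernel_mul_gammaKernel_sub (δ k s t : ℝ) :
    gammaKernel δ (δ + Complex.I) s * gammaKernel δ (δ + Complex.I) (s - t) *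
        Complex.exp (Complex.I * k * s) =
      Complex.exp (-(δ * t) + (2 * δ + Complex.I * k) * xC t) *
        gammaKernel (2 * δ + Complex.I * k) (δ + Complex.I) (s - xC t) := by
  simp only [gammaKernel, ← Complex.exp_add, exp_sub_xC, sub_eq_add_neg s t, Real.exp_add]
  congr 1
  push_cast
  ring

/-- The convolution of `f` with the kernel `gammaKernel δ (δ + I)`. -/
noncomputable def gammaConv (δ : ℝ) (f : ℝ → ℂ) : ℝ → ℂ :=
  convolution f (gammaKernel δ (δ + Complex.I)) (ContinuousLinearMap.mul ℂ ℂ) volume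

section

variable {f : ℝ → ℂ} {δ : ℝ}

theorem integrable_gammaKernel_add_I (hδ : 0 < δ) :
    Integrable (gammaKernel δ (δ + Complex.I)) :=
  integrable_gammaKernel (by simpa using hδ) (by simpa using hδ)

theorem integrable_gammaConv (hf : Integrable f) (hδ : 0 < δ) : Integrable (gammaConv δ f) :=
  hf.integrable_convolution _ (integrable_gammaKernel_add_I hδ)

theorem norm_gammaConv_le (hf : Integrable f) (hδ : 0 ≤ δ) (s : ℝ) :
    ‖gammaConv δ f s‖ ≤ ∫ t, ‖f t‖ := by
  refine norm_integral_le_of_norm_le hf.norm (.of_forall fun t => ?_)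
  rw [ContinuousLinearMap.mul_apply', norm_mul]
  exact mul_le_of_le_one_right (norm_nonneg _) (norm_gammaKernel_le_one hδ _)

theorem norm_gammaKernel_mul_gammaConv_le (hδ : 0 ≤ δ) (s : ℝ) :
    ‖gammaKernel δ (δ + Complex.I) s * gammaConv δ f s‖ ≤ ‖gammaConv δ f s‖ := by
  rw [norm_mul]
  exact mul_le_of_le_one_left (norm_nonneg _) (norm_gammaKernel_le_one hδ s)

theorem integrable_gammaKernel_mul_gammaConv (hf : Integrable f) (hδ : 0 < δ) :
    Integrable fun s => gammaKernel δ (δ + Complex.I) s * gammaConv δ f s :=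
  (integrable_gammaConv hf hδ).bdd_mul (continuous_gammaKernel _ _).aestronglyMeasurable
    (.of_forall (norm_gammaKernel_le_one hδ.le))

theorem ft_gammaKernel_mul_gammaConv (hf : Integrable f) (hδ : 0 < δ) (k : ℝ) :
    ft (fun s => gammaKernel δ (δ + Complex.I) s * gammaConv δ f s) (-k) =
      (Real.sqrt (2 * Real.pi) : ℂ)⁻¹ *
        ((∫ s, gammaKernel (2 * δ + Complex.I * k) (δ + Complex.I) s) *
          ∫ t, f t * Complex.exp (-(δ * t) + (2 * δ + Complex.I * k) * xC t)) := by
  have hint : Integrable (fun p : ℝ × ℝ =>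
      (gammaKernel δ (δ + Complex.I) p.1 * Complex.exp (Complex.I * k * p.1)) *
        (f p.2 * gammaKernel δ (δ + Complex.I) (p.1 - p.2))) (volume.prod volume) := by
    refine (hf.convolution_integrand (ContinuousLinearMap.mul ℂ ℂ)
      (integrable_gammaKernel_add_I hδ)).bdd_mul (c := 1) ?_ (.of_forall fun p => ?_)
    · have := continuous_gammaKernel δ (δ + Complex.I)
      exact Continuous.aestronglyMeasurable (by fun_prop)
    · rw [norm_mul, mul_assoc, ← Complex.ofReal_mul, mul_comm Complex.I,
        Complex.norm_exp_ofReal_mul_I, mul_one]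
      exact norm_gammaKernel_le_one hδ.le _
  rw [ft]
  congr 1
  calc _ = ∫ s, ∫ t, (gammaKernel δ (δ + Complex.I) s * Complex.exp (Complex.I * k * s)) *
        (f t * gammaKernel δ (δ + Complex.I) (s - t)) := by
        congr 1
        ext s
        rw [integral_const_mul, gammaConv, convolution]
        simp only [ContinuousLinearMap.mul_apply']
        push_cast
        ring_nf
    _ = ∫ t, ∫ s, (gammaKernel δ (δ + Complex.I) s * Complex.exp (Complex.I * k * s)) *
        (f t * gammaKernel δ (δ + Complex.I) (s - t)) := integral_integral_swap hint
    _ = ∫ t, (∫ s, gammaKernel (2 * δ + Complex.I * k) (δ + Complex.I) s) *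
          (f t * Complex.exp (-(δ * t) + (2 * δ + Complex.I * k) * xC t)) := by
        congr 1
        ext t
        rw [← integral_sub_right_eq_self (gammaKernel _ _) (xC t), ← integral_mul_const]
        congr 1
        ext s
        linear_combination f t * gammaKernel_mul_gammaKernel_sub δ k s t
    _ = _ := integral_const_mul _ _

theorem lintegral_enorm_ft_gammaKernel_mul_gammaConv_le (hf : Integrable f)
    (hneg : ∀ᵐ p : ℝ, p ≤ 0 → ft f p = 0) (hδ : 0 < δ) (hδ1 : δ ≤ 1) :
    ∫⁻ k in Ioi 0, ‖ft (fun s => gammaKernel δ (δ + Complex.I) s * gammaConv δ f s) (-k)‖ₑ ^ 2 ≤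
      ∫⁻ p in Ioi 0, ENNReal.ofReal (‖ft f p‖ ^ 2 / p ^ 2) := by
  have hH := integrable_gammaConv hf hδ
  have hu := integrable_gammaKernel_mul_gammaConv hf hδ
  have hB := norm_gammaConv_le hf hδ.le
  have hle := norm_gammaKernel_mul_gammaConv_le (f := f) hδ.le
  calc _ ≤ ∫⁻ k, ‖ft (fun s => gammaKernel δ (δ + Complex.I) s * gammaConv δ f s) (-k)‖ₑ ^ 2 :=
        setLIntegral_le_lintegral _ _
    _ = ∫⁻ k, ‖ft (fun s => gammaKernel δ (δ + Complex.I) s * gammaConv δ f s) k‖ₑ ^ 2 :=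
        lintegral_neg_eq_self (μ := volume) (fun k =>
          ‖ft (fun s => gammaKernel δ (δ + Complex.I) s * gammaConv δ f s) k‖ₑ ^ 2)
    _ = ∫⁻ s, ‖gammaKernel δ (δ + Complex.I) s * gammaConv δ f s‖ₑ ^ 2 :=
        lintegral_enorm_ft_sq hu (hu.memLp_two_of_norm_le fun s => (hle s).trans (hB s))
    _ ≤ ∫⁻ s, ‖gammaConv δ f s‖ₑ ^ 2 := by
        gcongr with s
        exact enorm_le_iff_norm_le.2 (hle s)
    _ = ∫⁻ p, ‖ft (gammaConv δ f) p‖ₑ ^ 2 :=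
        (lintegral_enorm_ft_sq hH (hH.memLp_two_of_norm_le hB)).symm
    _ ≤ ∫⁻ p, (Ioi 0).indicator (fun p => ENNReal.ofReal (‖ft f p‖ ^ 2 / p ^ 2)) p := by
        refine lintegral_mono_ae ?_
        filter_upwards [hneg] with p hp
        rw [gammaConv, ft_convolution hf (integrable_gammaKernel_add_I hδ)]
        rcases le_or_gt p 0 with h0 | h0
        · simp [hp h0]
        rw [indicator_of_mem (mem_Ioi.2 h0), ← ofReal_norm,
          ← ENNReal.ofReal_pow (norm_nonneg _), ← div_pow]
        refine ENNReal.ofReal_le_ofReal (pow_le_pow_left₀ (norm_nonneg _) ?_ 2)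
        have hpi : (Real.sqrt (2 * Real.pi) : ℂ) ≠ 0 := by
          exact_mod_cast (Real.sqrt_pos.2 (by positivity)).ne'
        have e : ft (gammaKernel δ (δ + Complex.I)) p = (Real.sqrt (2 * Real.pi) : ℂ)⁻¹ *
            ∫ s, gammaKernel (δ - Complex.I * p) (δ + Complex.I) s := by
          rw [ft]
          congr 2
          ext s
          rw [gammaKernel, gammaKernel, ← Complex.exp_add]
          ring_nf
        rw [e, mul_left_comm, mul_inv_cancel_left₀ hpi, norm_mul, div_eq_mul_one_div]
        gcongr
        exact norm_integral_gammaKernel_le hδ hδ1 h0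
    _ = _ := lintegral_indicator measurableSet_Ioi _

theorem tendsto_integral_mul_exp_xC (hf : Integrable f) (k : ℝ) :
    Tendsto (fun δ : ℝ => ∫ t, f t * Complex.exp (-(δ * t) + (2 * δ + Complex.I * k) * xC t))
      (nhdsWithin 0 (Ioi 0)) (nhds (∫ t, f t * Complex.exp (Complex.I * k * xC t))) := by
  have hmeas : Measurable xC := by unfold xC; fun_prop
  refine tendsto_integral_filter_of_dominated_convergence (fun t => ‖f t‖)
    (.of_forall fun δ => hf.aestronglyMeasurable.mul ?_) ?_ hf.norm (.of_forall fun t => ?_)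
  · exact Measurable.aestronglyMeasurable (by fun_prop)
  · filter_upwards [self_mem_nhdsWithin] with δ hδ
    refine .of_forall fun t => ?_
    rw [norm_mul, Complex.norm_exp]
    refine mul_le_of_le_one_right (norm_nonneg _) (Real.exp_le_one_iff.2 ?_)
    have h1 : xC t ≤ 0 := neg_nonpos.2 (Real.log_nonneg (by linarith [Real.exp_pos (-t)]))
    have h2 : xC t ≤ t := by
      rw [xC, neg_le]
      exact (Real.le_log_iff_exp_le (by positivity)).2 (by linarith)
    have h3 : 0 < δ := hδ
    have e : (-(δ * t) + (2 * δ + Complex.I * k) * xC t : ℂ).re = δ * (xC t - t + xC t) := by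
      simp
      ring
    rw [e]
    exact mul_nonpos_of_nonneg_of_nonpos h3.le (by linarith)
  · have h : ContinuousAt (fun δ : ℝ =>
        f t * Complex.exp (-(δ * t) + (2 * δ + Complex.I * k) * xC t)) 0 := by fun_prop
    have h' := h.tendsto.mono_left (nhdsWithin_le_nhds (s := Ioi 0))
    simpa using h'

theorem measurable_ft (hf : Integrable f) : Measurable (ft f) := by
  have hcont : Continuous (𝓕 f) :=
    VectorFourier.fourierIntegral_continuous Real.continuous_fourierChar
      (by exact continuous_inner) hf
  rw [funext (ft_eq_fourier f)]
  fun_prop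

theorem lintegral_ofReal_norm_Fk_le (hf : Integrable f) (hneg : ∀ᵐ p : ℝ, p ≤ 0 → ft f p = 0) :
    ∫⁻ k in Ioi 0, ENNReal.ofReal (2 * Real.pi / k * ‖Fk xC f (-k)‖ ^ 2) ≤
      ∫⁻ p in Ioi 0, ENNReal.ofReal (‖ft f p‖ ^ 2 / p ^ 2) := by
  let δ : ℕ → ℝ := fun n => 1 / ((n : ℝ) + 1)
  have hδ0 (n) : 0 < δ n := by positivity
  have hδ1 (n) : δ n ≤ 1 := div_le_one_of_le₀ (by linarith [n.cast_nonneg (α := ℝ)]) (by positivity)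
  have hδ : Tendsto δ atTop (nhdsWithin 0 (Ioi 0)) :=
    tendsto_nhdsWithin_iff.2 ⟨tendsto_one_div_add_atTop_nhds_zero_nat, .of_forall hδ0⟩
  let u : ℕ → ℝ → ℂ := fun n s => gammaKernel (δ n) (δ n + Complex.I) s * gammaConv (δ n) f s
  calc _ ≤ ∫⁻ k in Ioi 0, liminf (fun n => ‖ft (u n) (-k)‖ₑ ^ 2) atTop := by
        refine setLIntegral_mono' measurableSet_Ioi fun k hk => ?_
        have hlim := ENNReal.Tendsto.pow (n := 2) ((((tendsto_integral_gammaKernel hk).comp hδ).mul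
          ((tendsto_integral_mul_exp_xC hf k).comp hδ)).const_mul
            (Real.sqrt (2 * Real.pi) : ℂ)⁻¹).enorm
        have hlim' : Tendsto (fun n => ‖ft (u n) (-k)‖ₑ ^ 2) atTop _ :=
          hlim.congr fun n => by rw [ft_gammaKernel_mul_gammaConv hf (hδ0 n)]; rfl
        have hFk : Fk xC f (-k) = (Real.sqrt (2 * Real.pi) : ℂ)⁻¹ *
            ∫ t, f t * Complex.exp (Complex.I * k * xC t) := by
          rw [Fk]
          push_cast
          simp only [neg_mul_neg]
        rw [hlim'.liminf_eq, mul_left_comm, ← hFk, ← ofReal_norm,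
          ← ENNReal.ofReal_pow (norm_nonneg _), norm_mul, mul_pow]
        gcongr
        exact le_norm_cpow_mul_Gamma_sq hk
    _ ≤ liminf (fun n => ∫⁻ k in Ioi 0, ‖ft (u n) (-k)‖ₑ ^ 2) atTop :=
        lintegral_liminf_le fun n => by
          have := measurable_ft (integrable_gammaKernel_mul_gammaConv hf (hδ0 n))
          fun_prop
    _ ≤ _ := by
        refine (liminf_le_liminf (.of_forall fun n =>
          lintegral_enorm_ft_gammaKernel_mul_gammaConv_le hf hneg (hδ0 n) (hδ1 n))).trans_eq ?_
        exact liminf_const _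

end

/-- For the CGHS map there is a constant `C > 0` such that for every
integrable `f` with `f̂(p) = 0` for a.e. `p ≤ 0`,
`N̄_o[f] ≤ C ∫_0^∞ |f̂(p)|²/(2p(1-e^{-2πp})) dp` in `[0,∞]`. -/
theorem stmt_4 :
    ∃ C : ℝ, 0 < C ∧ ∀ f : ℝ → ℂ, MeasureTheory.Integrable f →
      (∀ᵐ p : ℝ, p ≤ 0 → ft f p = 0) →
      No xC f ≤ ENNReal.ofReal C *
        ∫⁻ p in Set.Ioi (0:ℝ), ENNReal.ofReal
          (‖ft f p‖ ^ 2 / (2 * p * (1 - Real.exp (-(2 * Real.pi) * p)))) := by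
  refine ⟨1, one_pos, fun f hf hneg => ?_⟩
  have hc : (0 : ℝ) < (4 * Real.pi)⁻¹ := by positivity
  rw [ENNReal.ofReal_one, one_mul]
  calc No xC f = ENNReal.ofReal (4 * Real.pi)⁻¹ *
        ∫⁻ k in Ioi 0, ENNReal.ofReal (2 * Real.pi / k * ‖Fk xC f (-k)‖ ^ 2) := by
        rw [← lintegral_const_mul' _ _ ENNReal.ofReal_ne_top, No]
        refine setLIntegral_congr_fun measurableSet_Ioi fun k hk => ?_
        have hk' : k ≠ 0 := (mem_Ioi.1 hk).ne'
        rw [← ENNReal.ofReal_mul hc.le]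
        congr 1
        field_simp
        norm_num
    _ ≤ ENNReal.ofReal (4 * Real.pi)⁻¹ *
        ∫⁻ p in Ioi 0, ENNReal.ofReal (‖ft f p‖ ^ 2 / p ^ 2) := by
        refine mul_le_mul_right ?_ _
        exact lintegral_ofReal_norm_Fk_le hf hneg
    _ ≤ _ := by
        rw [← lintegral_const_mul' _ _ ENNReal.ofReal_ne_top]
        refine setLIntegral_mono' measurableSet_Ioi fun p hp => ?_
        have hp' : 0 < p := hp
        rw [← ENNReal.ofReal_mul hc.le]
        refine ENNReal.ofReal_le_ofReal ?_
        have h1 : 0 < 1 - Real.exp (-(2 * Real.pi) * p) :=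
          sub_pos.2 (Real.exp_lt_one_iff.2 (by nlinarith [Real.pi_pos]))
        have h2 := Real.add_one_le_exp (-(2 * Real.pi) * p)
        calc (4 * Real.pi)⁻¹ * (‖ft f p‖ ^ 2 / p ^ 2)
            = ‖ft f p‖ ^ 2 / (2 * p * (2 * Real.pi * p)) := by
              field_simp
              ring
          _ ≤ _ := by
              gcongr
              linarith
end

section
/- Let x be either the relativistic map x_R(y) = −e^{−y} or the CGHS map x_C(y) = −log(1 + e^{−y}). Let f be a normalized outgoing wave function and g a normalized incoming wave function. Then, in [0, ∞], N̄_o[f] ≤ N̄_g[f] ≤ 1 + 3 N̄_o[f]. -/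
open MeasureTheory Set Filter
open scoped ENNReal

/-- `⟨g̃, Af̃⟩ = ∫_0^∞ conj(ĝ(k)) F̌(k)/(2k) dk`. -/
noncomputable def Aip (x : ℝ → ℝ) (g f : ℝ → ℂ) : ℂ :=
  ∫ k in Set.Ioi (0:ℝ), (starRingEnd ℂ) (ft g k) * Fk x f k / (2 * (k : ℂ))

/-- `⟨g̃*, Bf̃⟩ = ∫_0^∞ ĝ(k) F̌(-k)/(2k) dk`. -/
noncomputable def Bip (x : ℝ → ℝ) (g f : ℝ → ℂ) : ℂ :=
  ∫ k in Set.Ioi (0:ℝ), ft g k * Fk x f (-k) / (2 * (k : ℂ))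

/-- Wald's formula: the mean number of particles emitted when the incoming state is
the one-particle state `Ω_g`:  `N̄_g[f] = N̄_o[f] + |⟨g̃,Af̃⟩|² + |⟨g̃*,Bf̃⟩|²`. -/
noncomputable def Ng (x : ℝ → ℝ) (g f : ℝ → ℂ) : ℝ≥0∞ :=
  No x f + ENNReal.ofReal (‖Aip x g f‖ ^ 2) + ENNReal.ofReal (‖Bip x g f‖ ^ 2)

/-- The rank-one kernel `f ⊗ conj f`. -/
noncomputable def selfKernel (f : ℝ → ℂ) (z : ℝ × ℝ) : ℂ := f z.1 * (starRingEnd ℂ) (f z.2)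

lemma integrable_selfKernel {f : ℝ → ℂ} (hf : Integrable f) : Integrable (selfKernel f) := by
  have hc : Integrable (fun y => (starRingEnd ℂ) (f y)) := by
    refine hf.mono (Complex.continuous_conj.comp_aestronglyMeasurable hf.1) ?_
    exact Eventually.of_forall fun y => by simp
  exact hf.mul_prod hc

lemma norm_exp_phase (k u : ℝ) : ‖Complex.exp (-Complex.I * (k : ℂ) * (u : ℂ))‖ = 1 := by
  rw [Complex.norm_exp]; simp

lemma continuous_Fk {x : ℝ → ℝ} (hx : Measurable x) {f : ℝ → ℂ} (hf : Integrable f) :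
    Continuous (Fk x f) := by
  unfold Fk
  refine continuous_const.mul (continuous_of_dominated (bound := fun y => ‖f y‖) ?_ ?_ hf.norm ?_)
  · intro k
    exact hf.1.mul (by fun_prop : Measurable fun y : ℝ =>
      Complex.exp (-Complex.I * (k : ℂ) * (x y : ℂ))).aestronglyMeasurable
  · exact fun k => Eventually.of_forall fun y => by rw [norm_mul, norm_exp_phase, mul_one]
  · exact Eventually.of_forall fun y => by fun_prop

lemma sq_norm_Fk_eq (x : ℝ → ℝ) (f : ℝ → ℂ) (k : ℝ) :
    ((‖Fk x f k‖ ^ 2 : ℝ) : ℂ) = (2 * Real.pi : ℂ)⁻¹ * ∫ z : ℝ × ℝ, selfKernel f z *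
      Complex.exp (-Complex.I * (k : ℂ) * ((x z.1 - x z.2 : ℝ) : ℂ)) := by
  have h1 : ((‖Fk x f k‖ ^ 2 : ℝ) : ℂ) = Fk x f k * (starRingEnd ℂ) (Fk x f k) := by
    rw [Complex.mul_conj, Complex.normSq_eq_norm_sq]
  have h2 : (Real.sqrt (2 * Real.pi) : ℂ) * (Real.sqrt (2 * Real.pi) : ℂ) = 2 * Real.pi := by
    rw [← Complex.ofReal_mul, Real.mul_self_sqrt (by positivity)]; push_cast; rfl
  rw [h1, Fk, map_mul, ← integral_conj, map_inv₀, Complex.conj_ofReal, mul_mul_mul_comm,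
    ← integral_prod_mul, ← mul_inv, h2]
  congr 1
  refine integral_congr_ae (Eventually.of_forall fun z => ?_)
  simp only [selfKernel, map_mul, ← Complex.exp_conj, map_neg, Complex.conj_I,
    Complex.conj_ofReal]
  rw [mul_mul_mul_comm, ← Complex.exp_add]
  congr 2
  push_cast; ring

lemma exists_sq_norm_Fk_le (x : ℝ → ℝ) (f : ℝ → ℂ) :
    ∃ C, ∀ k, ‖Fk x f k‖ ^ 2 ≤ C := by
  refine ⟨(‖(Real.sqrt (2 * Real.pi) : ℂ)⁻¹‖ * ∫ y, ‖f y‖) ^ 2, fun k => ?_⟩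
  refine pow_le_pow_left₀ (norm_nonneg _) ?_ 2
  rw [Fk, norm_mul]
  refine mul_le_mul_of_nonneg_left ((norm_integral_le_integral_norm _).trans_eq ?_) (norm_nonneg _)
  simp only [norm_mul, norm_exp_phase, mul_one]

/-- The Laplace transform of the spectral density `k ↦ ‖F̌(s k)‖²`. -/
noncomputable def laplaceFk (x : ℝ → ℝ) (f : ℝ → ℂ) (s t : ℝ) : ℝ :=
  ∫ k in Ioi (0 : ℝ), Real.exp (-t * k) * ‖Fk x f (s * k)‖ ^ 2

lemma add_mul_I_ne_zero {t : ℝ} (ht : 0 < t) (v : ℝ) : (t : ℂ) + Complex.I * v ≠ 0 := by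
  intro h
  have := congrArg Complex.re h
  simp at this
  exact ht.ne' this

lemma laplaceFk_eq {x : ℝ → ℝ} (hx : Measurable x) {f : ℝ → ℂ} (hf : Integrable f) (s : ℝ)
    {t : ℝ} (ht : 0 < t) :
    ((laplaceFk x f s t : ℝ) : ℂ) = (2 * Real.pi : ℂ)⁻¹ * ∫ z : ℝ × ℝ, selfKernel f z *
      ((t : ℂ) + Complex.I * ((s * (x z.1 - x z.2) : ℝ) : ℂ))⁻¹ := by
  have hint : Integrable (Function.uncurry fun (k : ℝ) (z : ℝ × ℝ) =>
      Complex.exp (-Complex.I * ((s * k : ℝ) : ℂ) * ((x z.1 - x z.2 : ℝ) : ℂ)) *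
        ((Real.exp (-t * k) : ℂ) * selfKernel f z))
      ((volume.restrict (Ioi (0 : ℝ))).prod volume) := by
    have hexp : Integrable (fun k : ℝ => (Real.exp (-t * k) : ℂ)) (volume.restrict (Ioi 0)) :=
      (integrableOn_exp_mul_Ioi (neg_lt_zero.2 ht) 0).ofReal
    refine Integrable.bdd_mul (c := 1) (hexp.mul_prod (integrable_selfKernel hf)) ?_ ?_
    · exact (by fun_prop : Measurable fun p : ℝ × (ℝ × ℝ) =>
        Complex.exp (-Complex.I * ((s * p.1 : ℝ) : ℂ) *
          ((x p.2.1 - x p.2.2 : ℝ) : ℂ))).aestronglyMeasurable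
    · exact Eventually.of_forall fun p => (norm_exp_phase _ _).le
  have hk : ∀ k : ℝ, ((Real.exp (-t * k) * ‖Fk x f (s * k)‖ ^ 2 : ℝ) : ℂ) =
      (2 * Real.pi : ℂ)⁻¹ * ∫ z : ℝ × ℝ,
        Complex.exp (-Complex.I * ((s * k : ℝ) : ℂ) * ((x z.1 - x z.2 : ℝ) : ℂ)) *
        ((Real.exp (-t * k) : ℂ) * selfKernel f z) := by
    intro k
    rw [Complex.ofReal_mul, sq_norm_Fk_eq, mul_left_comm, ← integral_const_mul]
    congr 2
    ext z; ring
  rw [laplaceFk, ← integral_complex_ofReal]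
  simp_rw [hk]
  rw [integral_const_mul, integral_integral_swap hint]
  congr 2
  ext z
  have hz : ∀ k : ℝ,
      Complex.exp (-Complex.I * ((s * k : ℝ) : ℂ) * ((x z.1 - x z.2 : ℝ) : ℂ)) *
        ((Real.exp (-t * k) : ℂ) * selfKernel f z) =
      selfKernel f z * Complex.exp
        (-((t : ℂ) + Complex.I * ((s * (x z.1 - x z.2) : ℝ) : ℂ)) * (k : ℂ)) := by
    intro k
    rw [Complex.ofReal_exp, ← mul_assoc, ← Complex.exp_add, mul_comm]
    congr 2
    push_cast; ring
  simp_rw [hz]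
  rw [integral_const_mul, integral_exp_mul_complex_Ioi (by simpa using ht)]
  rw [Complex.ofReal_zero, mul_zero, Complex.exp_zero, neg_div_neg_eq, one_div]

lemma inv_sub_inv_phase {t : ℝ} (ht : 0 < t) (u : ℝ) :
    ((t : ℂ) + Complex.I * ((1 * u : ℝ) : ℂ))⁻¹ - ((t : ℂ) + Complex.I * ((-1 * u : ℝ) : ℂ))⁻¹ =
      -2 * Complex.I * ((u / (t ^ 2 + u ^ 2) : ℝ) : ℂ) := by
  have h1 := add_mul_I_ne_zero ht (1 * u)
  have h2 := add_mul_I_ne_zero ht (-1 * u)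
  have h3 : ((t : ℂ) ^ 2 + (u : ℂ) ^ 2) ≠ 0 := by
    have : t ^ 2 + u ^ 2 ≠ 0 := by positivity
    exact_mod_cast this
  rw [inv_sub_inv h1 h2, div_eq_iff (mul_ne_zero h1 h2)]
  push_cast
  field_simp
  ring_nf
  simp only [show Complex.I ^ 3 = -Complex.I by rw [pow_succ, Complex.I_sq]; ring]
  ring

lemma norm_inv_add_mul_I_le {t : ℝ} (ht : 0 < t) (v : ℝ) :
    ‖((t : ℂ) + Complex.I * (v : ℂ))⁻¹‖ ≤ t⁻¹ := by
  rw [norm_inv]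
  refine inv_anti₀ ht ?_
  have := Complex.re_le_norm ((t : ℂ) + Complex.I * (v : ℂ))
  simpa using this

lemma laplaceFk_sub_eq {x : ℝ → ℝ} (hx : Measurable x) {f : ℝ → ℂ} (hf : Integrable f)
    {t : ℝ} (ht : 0 < t) :
    ((laplaceFk x f 1 t - laplaceFk x f (-1) t : ℝ) : ℂ) =
      (2 * Real.pi : ℂ)⁻¹ * ∫ z : ℝ × ℝ, (-2 * Complex.I * selfKernel f z) *
        (((x z.1 - x z.2) / (t ^ 2 + (x z.1 - x z.2) ^ 2) : ℝ) : ℂ) := by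
  have hint : ∀ s : ℝ, Integrable fun z : ℝ × ℝ => selfKernel f z *
      ((t : ℂ) + Complex.I * ((s * (x z.1 - x z.2) : ℝ) : ℂ))⁻¹ := fun s =>
    (integrable_selfKernel hf).mul_bdd (c := t⁻¹)
      (by fun_prop : Measurable fun z : ℝ × ℝ =>
        ((t : ℂ) + Complex.I * ((s * (x z.1 - x z.2) : ℝ) : ℂ))⁻¹).aestronglyMeasurable
      (Eventually.of_forall fun z => norm_inv_add_mul_I_le ht _)
  rw [Complex.ofReal_sub, laplaceFk_eq hx hf 1 ht, laplaceFk_eq hx hf (-1) ht, ← mul_sub,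
    ← integral_sub (hint 1) (hint (-1))]
  congr 2
  ext z
  rw [← mul_sub, inv_sub_inv_phase ht]
  ring

lemma intervalIntegral_div_sq_add_sq {a b : ℝ} (ha : 0 < a) (hab : a ≤ b) (u : ℝ) :
    ∫ t in a..b, u / (t ^ 2 + u ^ 2) = Real.arctan (u / a) - Real.arctan (u / b) := by
  have hpos : ∀ t ∈ uIcc a b, 0 < t := fun t ht => ha.trans_le (uIcc_of_le hab ▸ ht).1
  rw [intervalIntegral.integral_eq_sub_of_hasDerivAt (f := fun t => -Real.arctan (u / t))]
  · ring
  · intro t ht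
    have h0 := hpos t ht
    have h := (((hasDerivAt_inv h0.ne').const_mul u).arctan).neg
    refine HasDerivAt.congr_deriv h ?_
    have : t ^ 2 + u ^ 2 ≠ 0 := by positivity
    have : 1 + (u * t⁻¹) ^ 2 ≠ 0 := by positivity
    field_simp
  · refine ContinuousOn.intervalIntegrable fun t ht => ContinuousAt.continuousWithinAt ?_
    have h0 := hpos t ht
    have : t ^ 2 + u ^ 2 ≠ 0 := by positivity
    fun_prop (disch := assumption)

lemma abs_div_sq_add_sq_le {a t : ℝ} (ha : 0 < a) (hat : a ≤ t) (u : ℝ) :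
    |u / (t ^ 2 + u ^ 2)| ≤ a⁻¹ := by
  have ht : 0 < t := ha.trans_le hat
  have hp : 0 < t ^ 2 + u ^ 2 := by positivity
  rw [abs_div, abs_of_pos hp, div_le_iff₀ hp, inv_mul_eq_div, le_div_iff₀ ha]
  nlinarith [abs_nonneg u, sq_abs u, sq_nonneg (t - |u|),
    mul_le_mul_of_nonneg_left hat (abs_nonneg u)]

lemma integral_laplaceFk_sub_eq {x : ℝ → ℝ} (hx : Measurable x) {f : ℝ → ℂ} (hf : Integrable f)
    {a b : ℝ} (ha : 0 < a) (hab : a ≤ b) :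
    ((∫ t in Ioc a b, (laplaceFk x f 1 t - laplaceFk x f (-1) t) : ℝ) : ℂ) =
      (2 * Real.pi : ℂ)⁻¹ * ∫ z : ℝ × ℝ, (-2 * Complex.I * selfKernel f z) *
        ((Real.arctan ((x z.1 - x z.2) / a) - Real.arctan ((x z.1 - x z.2) / b) : ℝ) : ℂ) := by
  have hint : Integrable (Function.uncurry fun (t : ℝ) (z : ℝ × ℝ) =>
      (-2 * Complex.I * selfKernel f z) *
        (((x z.1 - x z.2) / (t ^ 2 + (x z.1 - x z.2) ^ 2) : ℝ) : ℂ))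
      ((volume.restrict (Ioc a b)).prod volume) := by
    have hK : Integrable (fun p : ℝ × (ℝ × ℝ) => -2 * Complex.I * selfKernel f p.2)
        ((volume.restrict (Ioc a b)).prod volume) :=
      ((integrable_selfKernel hf).const_mul (-2 * Complex.I)).comp_snd _
    refine hK.mul_bdd (c := a⁻¹) ?_ ?_
    · exact (by fun_prop : Measurable fun p : ℝ × (ℝ × ℝ) =>
        (((x p.2.1 - x p.2.2) / (p.1 ^ 2 + (x p.2.1 - x p.2.2) ^ 2) : ℝ) : ℂ)).aestronglyMeasurable
    · have h : ∀ᵐ p ∂((volume.restrict (Ioc a b)).prod (volume : Measure (ℝ × ℝ))),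
          p.1 ∈ Ioc a b :=
        Measure.quasiMeasurePreserving_fst.ae (ae_restrict_mem measurableSet_Ioc)
      filter_upwards [h] with p hp
      rw [Complex.norm_real]
      exact abs_div_sq_add_sq_le ha hp.1.le _
  rw [← integral_complex_ofReal, setIntegral_congr_fun measurableSet_Ioc
    (fun t ht => laplaceFk_sub_eq hx hf (ha.trans ht.1)), integral_const_mul,
    integral_integral_swap hint]
  congr 2
  ext z
  rw [integral_const_mul, integral_complex_ofReal, ← intervalIntegral_div_sq_add_sq ha hab,
    intervalIntegral.integral_of_le hab]

lemma tendsto_arctan_mul (u : ℝ) :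
    Tendsto (fun n : ℕ => Real.arctan (u / (n + 1 : ℝ)⁻¹) - Real.arctan (u / (n + 1 : ℝ)))
      atTop (nhds (SignType.sign u * (Real.pi / 2))) := by
  have hn : Tendsto (fun n : ℕ => (n + 1 : ℝ)) atTop atTop :=
    tendsto_atTop_add_const_right _ _ tendsto_natCast_atTop_atTop
  have h2 : Tendsto (fun n : ℕ => Real.arctan (u / (n + 1 : ℝ))) atTop (nhds 0) := by
    simpa [Function.comp_def] using
      (Real.continuous_arctan.tendsto 0).comp (hn.const_div_atTop u)
  have h1 : Tendsto (fun n : ℕ => Real.arctan (u / (n + 1 : ℝ)⁻¹)) atTop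
      (nhds (SignType.sign u * (Real.pi / 2))) := by
    simp only [div_inv_eq_mul]
    rcases lt_trichotomy u 0 with hu | rfl | hu
    · have := (Real.tendsto_arctan_atBot.mono_right nhdsWithin_le_nhds).comp
        (hn.const_mul_atTop_of_neg hu)
      simpa [sign_neg hu, neg_div, Function.comp_def] using this
    · simp
    · have := (Real.tendsto_arctan_atTop.mono_right nhdsWithin_le_nhds).comp
        (hn.const_mul_atTop hu)
      simpa [sign_pos hu, Function.comp_def] using this
  simpa using h1.sub h2

/-- For increasing `x`, the regularised charge `∫ |F̌(k)|² / k dk` converges to a limit that does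
not depend on `x`. -/
lemma tendsto_integral_laplaceFk_sub {x : ℝ → ℝ} (hx : StrictMono x) {f : ℝ → ℂ}
    (hf : Integrable f) :
    Tendsto (fun n : ℕ => ((∫ t in Ioc (n + 1 : ℝ)⁻¹ (n + 1 : ℝ),
        (laplaceFk x f 1 t - laplaceFk x f (-1) t) : ℝ) : ℂ)) atTop
      (nhds ((2 * Real.pi : ℂ)⁻¹ * ∫ z : ℝ × ℝ, (-2 * Complex.I * selfKernel f z) *
        ((SignType.sign (z.1 - z.2) * (Real.pi / 2) : ℝ) : ℂ))) := by
  have hxm : Measurable x := hx.monotone.measurable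
  have hK : Integrable (fun z => -2 * Complex.I * selfKernel f z) :=
    (integrable_selfKernel hf).const_mul (-2 * Complex.I)
  have hsign : ∀ z : ℝ × ℝ, SignType.sign (z.1 - z.2) = SignType.sign (x z.1 - x z.2) := by
    intro z
    rcases lt_trichotomy z.1 z.2 with h | h | h
    · rw [sign_neg (sub_neg.2 h), sign_neg (sub_neg.2 (hx h))]
    · simp [h]
    · rw [sign_pos (sub_pos.2 h), sign_pos (sub_pos.2 (hx h))]
  have hab : ∀ n : ℕ, (n + 1 : ℝ)⁻¹ ≤ n + 1 := fun n =>
    (inv_le_one_of_one_le₀ (by simp)).trans (by simp)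
  simp_rw [fun n : ℕ => integral_laplaceFk_sub_eq hxm hf
    (by positivity : (0 : ℝ) < (n + 1 : ℝ)⁻¹) (hab n), hsign]
  refine Tendsto.const_mul _ (tendsto_integral_of_dominated_convergence
    (fun z => ‖-2 * Complex.I * selfKernel f z‖ * Real.pi) ?_ (hK.norm.mul_const _) ?_ ?_)
  · intro n
    exact hK.1.mul (by fun_prop : Measurable fun z : ℝ × ℝ =>
      ((Real.arctan ((x z.1 - x z.2) / (n + 1 : ℝ)⁻¹) -
        Real.arctan ((x z.1 - x z.2) / (n + 1 : ℝ)) : ℝ) : ℂ)).aestronglyMeasurable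
  · refine fun n => Eventually.of_forall fun z => ?_
    rw [norm_mul, Complex.norm_real, Real.norm_eq_abs]
    refine mul_le_mul_of_nonneg_left ?_ (norm_nonneg _)
    have h1 := Real.arctan_lt_pi_div_two ((x z.1 - x z.2) / (n + 1 : ℝ)⁻¹)
    have h2 := Real.neg_pi_div_two_lt_arctan ((x z.1 - x z.2) / (n + 1 : ℝ)⁻¹)
    have h3 := Real.arctan_lt_pi_div_two ((x z.1 - x z.2) / (n + 1 : ℝ))
    have h4 := Real.neg_pi_div_two_lt_arctan ((x z.1 - x z.2) / (n + 1 : ℝ))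
    rw [abs_le]; constructor <;> linarith
  · refine Eventually.of_forall fun z => ?_
    exact ((Complex.continuous_ofReal.tendsto _).comp (tendsto_arctan_mul _)).const_mul _

lemma measurable_exp_mul_sq_norm_Fk {x : ℝ → ℝ} (hx : Measurable x) {f : ℝ → ℂ}
    (hf : Integrable f) (s : ℝ) :
    Measurable fun p : ℝ × ℝ => Real.exp (-p.1 * p.2) * ‖Fk x f (s * p.2)‖ ^ 2 := by
  have := (continuous_Fk hx hf).measurable
  fun_prop

lemma integrableOn_exp_mul_sq_norm_Fk {x : ℝ → ℝ} (hx : Measurable x) {f : ℝ → ℂ}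
    (hf : Integrable f) (s : ℝ) {t : ℝ} (ht : 0 < t) :
    IntegrableOn (fun k => Real.exp (-t * k) * ‖Fk x f (s * k)‖ ^ 2) (Ioi 0) := by
  obtain ⟨C, hC⟩ := exists_sq_norm_Fk_le x f
  have hF := (continuous_Fk hx hf).measurable
  refine (integrableOn_exp_mul_Ioi (neg_lt_zero.2 ht) 0).mul_bdd (c := C)
    (by fun_prop : Measurable fun k => ‖Fk x f (s * k)‖ ^ 2).aestronglyMeasurable
    (Eventually.of_forall fun k => ?_)
  rw [Real.norm_of_nonneg (by positivity)]
  exact hC _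

lemma measurable_laplaceFk {x : ℝ → ℝ} (hx : Measurable x) {f : ℝ → ℂ} (hf : Integrable f)
    (s : ℝ) : Measurable (laplaceFk x f s) :=
  (measurable_exp_mul_sq_norm_Fk hx hf s).stronglyMeasurable.integral_prod_right'.measurable

lemma laplaceFk_nonneg (x : ℝ → ℝ) (f : ℝ → ℂ) (s t : ℝ) : 0 ≤ laplaceFk x f s t :=
  integral_nonneg fun k => by positivity

lemma integrableOn_laplaceFk {x : ℝ → ℝ} (hx : Measurable x) {f : ℝ → ℂ} (hf : Integrable f)
    (s : ℝ) {a : ℝ} (ha : 0 < a) (b : ℝ) : IntegrableOn (laplaceFk x f s) (Ioc a b) := by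
  refine IntegrableOn.of_bound (C := laplaceFk x f s a) measure_Ioc_lt_top
    (measurable_laplaceFk hx hf s).aestronglyMeasurable ?_
  refine (ae_restrict_iff' measurableSet_Ioc).2 (Eventually.of_forall fun t ht => ?_)
  rw [Real.norm_of_nonneg (laplaceFk_nonneg x f s t)]
  refine setIntegral_mono_on (integrableOn_exp_mul_sq_norm_Fk hx hf s (ha.trans ht.1))
    (integrableOn_exp_mul_sq_norm_Fk hx hf s ha) measurableSet_Ioi fun k hk => ?_
  have : -t * k ≤ -a * k := mul_le_mul_of_nonneg_right (neg_le_neg ht.1.le) (le_of_lt hk)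
  gcongr

lemma lintegral_exp_neg_mul {k : ℝ} (hk : 0 < k) :
    ∫⁻ t in Ioi (0 : ℝ), ENNReal.ofReal (Real.exp (-t * k)) = ENNReal.ofReal (1 / k) := by
  simp_rw [neg_mul_comm, mul_comm _ (-k)]
  rw [← ofReal_integral_eq_lintegral_ofReal (integrableOn_exp_mul_Ioi (neg_lt_zero.2 hk) 0)
    (Eventually.of_forall fun t => (Real.exp_pos _).le), integral_exp_mul_Ioi (neg_lt_zero.2 hk)]
  simp

lemma lintegral_laplaceFk {x : ℝ → ℝ} (hx : Measurable x) {f : ℝ → ℂ} (hf : Integrable f)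
    (s : ℝ) :
    ∫⁻ t in Ioi (0 : ℝ), ENNReal.ofReal (laplaceFk x f s t) =
      2 * ∫⁻ k in Ioi (0 : ℝ), ENNReal.ofReal (‖Fk x f (s * k)‖ ^ 2 / (2 * k)) := by
  have hF := (continuous_Fk hx hf).measurable
  have h1 : ∀ t ∈ Ioi (0 : ℝ), ENNReal.ofReal (laplaceFk x f s t) =
      ∫⁻ k in Ioi (0 : ℝ), ENNReal.ofReal (Real.exp (-t * k) * ‖Fk x f (s * k)‖ ^ 2) :=
    fun t ht => ofReal_integral_eq_lintegral_ofReal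
      (integrableOn_exp_mul_sq_norm_Fk hx hf s ht) (Eventually.of_forall fun k => by positivity)
  rw [setLIntegral_congr_fun measurableSet_Ioi h1, lintegral_lintegral_swap
    (measurable_exp_mul_sq_norm_Fk hx hf s).ennreal_ofReal.aemeasurable,
    ← lintegral_const_mul _ (by fun_prop)]
  refine setLIntegral_congr_fun measurableSet_Ioi fun k (hk : 0 < k) => ?_
  simp_rw [ENNReal.ofReal_mul (Real.exp_pos _).le]
  rw [lintegral_mul_const _ (by fun_prop), lintegral_exp_neg_mul hk,
    ← ENNReal.ofReal_mul (by positivity), ← ENNReal.ofReal_ofNat 2,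
    ← ENNReal.ofReal_mul (by positivity)]
  congr 1
  field_simp

lemma tendsto_lintegral_laplaceFk {x : ℝ → ℝ} (hx : Measurable x) {f : ℝ → ℂ}
    (hf : Integrable f) (s : ℝ) :
    Tendsto (fun n : ℕ => ∫⁻ t in Ioc (n + 1 : ℝ)⁻¹ (n + 1 : ℝ),
        ENNReal.ofReal (laplaceFk x f s t)) atTop
      (nhds (∫⁻ t in Ioi (0 : ℝ), ENNReal.ofReal (laplaceFk x f s t))) := by
  have hn : Tendsto (fun n : ℕ => (n + 1 : ℝ)) atTop atTop :=
    tendsto_atTop_add_const_right _ _ tendsto_natCast_atTop_atTop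
  have hcover : AECover (volume.restrict (Ioi (0 : ℝ))) atTop
      fun n : ℕ => Ioi (n + 1 : ℝ)⁻¹ ∩ Iic (n + 1 : ℝ) :=
    (aecover_Ioi_of_Ioi hn.inv_tendsto_atTop).inter (aecover_Iic hn).restrict
  refine (hcover.lintegral_tendsto_of_nat
    (measurable_laplaceFk hx hf s).ennreal_ofReal.aemeasurable).congr fun n => ?_
  rw [Ioi_inter_Iic, Measure.restrict_restrict measurableSet_Ioc, inter_eq_left.2]
  exact fun t ht => lt_trans (by positivity) ht.1

lemma strictMono_of_eq_xR_or_xC {x : ℝ → ℝ} (hx : x = xR ∨ x = xC) : StrictMono x := by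
  rcases hx with rfl | rfl
  · intro y z h
    simpa [xR] using h
  · intro y z h
    have : Real.exp (-z) < Real.exp (-y) := Real.exp_lt_exp.2 (neg_lt_neg h)
    exact neg_lt_neg (Real.log_lt_log (by positivity) (by linarith))

/-- Conservation of charge, as an inequality: for a normalized positive-frequency `f`, the
positive-frequency norm after an increasing change of coordinate is at most `1 + N̄_o[f]`. -/
lemma lintegral_sq_norm_Fk_le {x : ℝ → ℝ} (hx : StrictMono x) {f : ℝ → ℂ} (hf : Integrable f)
    (hfp : ∀ᵐ p : ℝ, p ≤ 0 → ft f p = 0)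
    (hfn : (∫⁻ p in Ioi (0 : ℝ), ENNReal.ofReal (‖ft f p‖ ^ 2 / (2 * p))) = 1) :
    ∫⁻ k in Ioi (0 : ℝ), ENNReal.ofReal (‖Fk x f k‖ ^ 2 / (2 * k)) ≤ 1 + No x f := by
  have hxm : Measurable x := hx.monotone.measurable
  have hneg : ∀ t, laplaceFk id f (-1) t = 0 := by
    intro t
    have h : ∀ᵐ k : ℝ, -k ≤ 0 → ft f (-k) = 0 :=
      (Measure.measurePreserving_neg volume).quasiMeasurePreserving.ae hfp
    refine integral_eq_zero_of_ae ((ae_restrict_iff' measurableSet_Ioi).2 ?_)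
    filter_upwards [h] with k hk h0
    have : Fk id f (-k) = 0 := hk (neg_nonpos.2 (le_of_lt h0))
    simp [this]
  have hone : ∫⁻ t in Ioi (0 : ℝ), ENNReal.ofReal (laplaceFk id f 1 t) = 2 := by
    rw [lintegral_laplaceFk measurable_id hf]
    simp_rw [one_mul]
    exact (congrArg (2 * ·) hfn).trans (mul_one 2)
  have hLx := (Complex.continuous_re.tendsto _).comp (tendsto_integral_laplaceFk_sub hx hf)
  have hLid := (Complex.continuous_re.tendsto _).comp
    (tendsto_integral_laplaceFk_sub (x := id) strictMono_id hf)
  simp only [Function.comp_def, Complex.ofReal_re] at hLx hLid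
  set L := ((2 * Real.pi : ℂ)⁻¹ * ∫ z : ℝ × ℝ, (-2 * Complex.I * selfKernel f z) *
        ((SignType.sign (z.1 - z.2) * (Real.pi / 2) : ℝ) : ℂ)).re
  have hpos : ∀ n : ℕ, (0 : ℝ) < (n + 1 : ℝ)⁻¹ := fun n => by positivity
  have hL : ENNReal.ofReal L ≤ 2 := by
    refine le_of_tendsto (ENNReal.tendsto_ofReal hLid) (Eventually.of_forall fun n => ?_)
    simp_rw [hneg, sub_zero]
    rw [ofReal_integral_eq_lintegral_ofReal
      (integrableOn_laplaceFk measurable_id hf 1 (hpos n) _)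
      (Eventually.of_forall fun t => laplaceFk_nonneg _ _ _ _), ← hone]
    exact lintegral_mono_set fun t ht => lt_trans (hpos n) ht.1
  have hbound : ∀ n : ℕ, ∫⁻ t in Ioc (n + 1 : ℝ)⁻¹ (n + 1 : ℝ),
      ENNReal.ofReal (laplaceFk x f 1 t) ≤
      ENNReal.ofReal (∫ t in Ioc (n + 1 : ℝ)⁻¹ (n + 1 : ℝ),
        (laplaceFk x f 1 t - laplaceFk x f (-1) t)) +
      ∫⁻ t in Ioi (0 : ℝ), ENNReal.ofReal (laplaceFk x f (-1) t) := by
    intro n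
    have h1 := integrableOn_laplaceFk hxm hf 1 (hpos n) (n + 1)
    have h2 := integrableOn_laplaceFk hxm hf (-1) (hpos n) (n + 1)
    have hsub : ∫⁻ t in Ioc (n + 1 : ℝ)⁻¹ (n + 1 : ℝ), ENNReal.ofReal (laplaceFk x f (-1) t) ≤
        ∫⁻ t in Ioi (0 : ℝ), ENNReal.ofReal (laplaceFk x f (-1) t) :=
      lintegral_mono_set fun t ht => lt_trans (hpos n) ht.1
    refine le_trans ?_ (add_le_add_right hsub _)
    rw [← ofReal_integral_eq_lintegral_ofReal h1
      (Eventually.of_forall fun t => laplaceFk_nonneg _ _ _ _),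
      ← ofReal_integral_eq_lintegral_ofReal h2
      (Eventually.of_forall fun t => laplaceFk_nonneg _ _ _ _), integral_sub h1 h2]
    refine le_trans (ENNReal.ofReal_le_ofReal ?_) ENNReal.ofReal_add_le
    linarith
  have hlim := le_of_tendsto_of_tendsto' (tendsto_lintegral_laplaceFk hxm hf 1)
    ((ENNReal.tendsto_ofReal hLx).add_const _) hbound
  rw [lintegral_laplaceFk hxm hf, lintegral_laplaceFk hxm hf] at hlim
  simp_rw [one_mul, neg_one_mul] at hlim
  have h := hlim.trans (add_le_add_left hL _)
  rw [show (2 : ℝ≥0∞) + 2 * ∫⁻ k in Ioi (0 : ℝ), ENNReal.ofReal (‖Fk x f (-k)‖ ^ 2 / (2 * k)) =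
    2 * (1 + No x f) by rw [No, mul_add, mul_one]] at h
  exact (ENNReal.mul_le_mul_iff_right two_ne_zero ENNReal.ofNat_ne_top).1 h

/-- Cauchy–Schwarz for the weight `1 / (2k)` on the half-line. -/
lemma ofReal_sq_norm_integral_le {G F : ℝ → ℂ} (hG : Measurable G) (hF : Measurable F)
    (hG1 : (∫⁻ k in Ioi (0 : ℝ), ENNReal.ofReal (‖G k‖ ^ 2 / (2 * k))) = 1) :
    ENNReal.ofReal (‖∫ k in Ioi (0 : ℝ), G k * F k / (2 * (k : ℂ))‖ ^ 2) ≤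
      ∫⁻ k in Ioi (0 : ℝ), ENNReal.ofReal (‖F k‖ ^ 2 / (2 * k)) := by
  have key : ∀ H : ℝ → ℂ, ∀ k ∈ Ioi (0 : ℝ),
      ENNReal.ofReal (‖H k‖ / Real.sqrt (2 * k)) ^ (2 : ℝ) =
        ENNReal.ofReal (‖H k‖ ^ 2 / (2 * k)) := by
    intro H k (hk : 0 < k)
    rw [ENNReal.rpow_ofNat, ← ENNReal.ofReal_pow (by positivity), div_pow,
      Real.sq_sqrt (by positivity)]
  have hCS := ENNReal.lintegral_mul_le_Lp_mul_Lq (volume.restrict (Ioi (0 : ℝ)))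
    (f := fun k => ENNReal.ofReal (‖G k‖ / Real.sqrt (2 * k)))
    (g := fun k => ENNReal.ofReal (‖F k‖ / Real.sqrt (2 * k)))
    Real.HolderConjugate.two_two (by fun_prop) (by fun_prop)
  rw [setLIntegral_congr_fun measurableSet_Ioi (key G),
    setLIntegral_congr_fun measurableSet_Ioi (key F), hG1, ENNReal.one_rpow, one_mul] at hCS
  have hnorm : ENNReal.ofReal ‖∫ k in Ioi (0 : ℝ), G k * F k / (2 * (k : ℂ))‖ ≤
      (∫⁻ k in Ioi (0 : ℝ), ENNReal.ofReal (‖F k‖ ^ 2 / (2 * k))) ^ (1 / 2 : ℝ) := by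
    rw [ofReal_norm]
    refine (enorm_integral_le_lintegral_enorm _).trans (le_of_eq_of_le ?_ hCS)
    refine setLIntegral_congr_fun measurableSet_Ioi fun k (hk : 0 < k) => ?_
    simp only [Pi.mul_apply]
    rw [← ofReal_norm, ← ENNReal.ofReal_mul (by positivity), div_mul_div_comm,
      Real.mul_self_sqrt (by positivity), norm_div, norm_mul, norm_mul, Complex.norm_real,
      Complex.norm_ofNat, Real.norm_of_nonneg hk.le]
  rw [ENNReal.ofReal_pow (norm_nonneg _)]
  refine (pow_le_pow_left' hnorm 2).trans_eq ?_
  rw [← ENNReal.rpow_ofNat, ← ENNReal.rpow_mul]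
  norm_num

/-- For `x = x_R` or `x = x_C`, a normalized outgoing wave function `f`
and a normalized incoming wave function `g`, one has `N̄_o[f] ≤ N̄_g[f] ≤ 1 + 3N̄_o[f]`
in `[0,∞]`. -/
theorem stmt_7 (x : ℝ → ℝ) (hx : x = xR ∨ x = xC) (f g : ℝ → ℂ)
    (hf : MeasureTheory.Integrable f)
    (hfp : ∀ᵐ p : ℝ, p ≤ 0 → ft f p = 0)
    (hfn : (∫⁻ p in Set.Ioi (0:ℝ),
        ENNReal.ofReal (‖ft f p‖ ^ 2 / (2 * p))) = 1)
    (hg : MeasureTheory.Integrable g)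
    (hgp : ∀ᵐ k : ℝ, k ≤ 0 → ft g k = 0)
    (hgn : (∫⁻ k in Set.Ioi (0:ℝ),
        ENNReal.ofReal (‖ft g k‖ ^ 2 / (2 * k))) = 1) :
    No x f ≤ Ng x g f ∧ Ng x g f ≤ 1 + 3 * No x f := by
  have hx' := strictMono_of_eq_xR_or_xC hx
  have hxm : Measurable x := hx'.monotone.measurable
  have hF := (continuous_Fk hxm hf).measurable
  have hG : Measurable (ft g) := (continuous_Fk measurable_id hg).measurable
  refine ⟨by rw [Ng, add_assoc]; exact le_self_add, ?_⟩
  have hA : ENNReal.ofReal (‖Aip x g f‖ ^ 2) ≤ 1 + No x f :=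
    (ofReal_sq_norm_integral_le (G := fun k => (starRingEnd ℂ) (ft g k))
      (Complex.continuous_conj.measurable.comp hG) hF (by simpa using hgn)).trans
      (lintegral_sq_norm_Fk_le hx' hf hfp hfn)
  have hB : ENNReal.ofReal (‖Bip x g f‖ ^ 2) ≤ No x f :=
    ofReal_sq_norm_integral_le (F := fun k => Fk x f (-k)) hG (hF.comp measurable_neg) hgn
  calc Ng x g f ≤ No x f + (1 + No x f) + No x f := add_le_add (add_le_add le_rfl hA) hB
    _ = 1 + 3 * No x f := by ring
end
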